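/- There is an infinite set S of positive integers such that for every m ∈ S, n_m ≤ 0.4643·(m-2)^{m-2}. -/

import Mathlib

/-- A graph `G` is `k`-choosable if for every assignment of lists of `k` colors
to the vertices there is a proper coloring choosing each vertex's color from its list. -/
def Choosable {V : Type*} (G : SimpleGraph V) (k : ℕ) : Prop :=
  ∀ L : V → Finset ℕ, (∀ v, (L v).card = k) →
    ∃ c : V → ℕ, (∀ v, c v ∈ L v) ∧ ∀ u w, G.Adj u w → c u ≠ c w

/-- The choice number of `G` is the least `k` such that `G` is `k`-choosable. -/
noncomputable def choiceNumber {V : Type*} (G : SimpleGraph V) : ℕ :=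
  sInf {k | Choosable G k}

/-- `nm m` is the smallest integer `n` such that `ch (K_{m,n}) = m - 1`. -/
noncomputable def nm (m : ℕ) : ℕ :=
  sInf {n | choiceNumber (completeBipartiteGraph (Fin m) (Fin n)) = m - 1}

open Finset Filter Topology

theorem Choosable.mono {V : Type*} {G : SimpleGraph V} {j k : ℕ} (hjk : j ≤ k)
    (h : Choosable G j) : Choosable G k := by
  intro L hL
  choose L' hsub hcard using fun v => Finset.exists_subset_card_eq (hjk.trans (hL v).ge)
  obtain ⟨c, hc, hadj⟩ := h L' hcard
  exact ⟨c, fun v => hsub v (hc v), hadj⟩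

theorem choosable_completeBipartiteGraph_zero (m : ℕ) {k : ℕ} (hk : 0 < k) :
    Choosable (completeBipartiteGraph (Fin m) (Fin 0)) k := by
  intro L hL
  have hne : ∀ v, (L v).Nonempty := fun v => by
    rw [← Finset.card_pos, hL]; exact hk
  choose c hc using hne
  refine ⟨c, hc, ?_⟩
  rintro (u | u) (w | w) h
  · simp at h
  · exact w.elim0
  · exact u.elim0
  · simp at h

/-- Adding a vertex to the second part raises the choice number by at most one. -/
theorem Choosable.completeBipartiteGraph_succ {m n k : ℕ}
    (h : Choosable (completeBipartiteGraph (Fin m) (Fin n)) k) :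
    Choosable (completeBipartiteGraph (Fin m) (Fin (n + 1))) (k + 1) := by
  intro L hL
  have hne : (L (Sum.inr (Fin.last n))).Nonempty := by
    rw [← Finset.card_pos, hL]; omega
  obtain ⟨x, hx⟩ := hne
  have hle : ∀ v : Fin m ⊕ Fin n, k ≤ ((L (Sum.map id Fin.castSucc v)).erase x).card := by
    intro v
    have := Finset.pred_card_le_card_erase (s := L (Sum.map id Fin.castSucc v)) (a := x)
    rw [hL] at this
    simpa using this
  choose L' hsub hcard using fun v => Finset.exists_subset_card_eq (hle v)
  obtain ⟨c, hc, hadj⟩ := h L' hcard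
  have hc' := fun v => Finset.mem_erase.1 (hsub v (hc v))
  have hcross : ∀ a b, c (Sum.inl a) ≠ c (Sum.inr b) := fun a b => hadj _ _ (by simp)
  refine ⟨Sum.elim (fun a => c (Sum.inl a))
    (Fin.lastCases x fun b => c (Sum.inr b)), ?_, ?_⟩
  · rintro (a | b)
    · exact (hc' (Sum.inl a)).2
    · induction b using Fin.lastCases with
      | last => simpa using hx
      | cast b => simpa using (hc' (Sum.inr b)).2
  · have key : ∀ (a : Fin m) (b : Fin (n + 1)), c (Sum.inl a) ≠
        (Fin.lastCases x (fun b => c (Sum.inr b)) b : ℕ) := by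
      intro a b
      induction b using Fin.lastCases with
      | last => simpa using (hc' (Sum.inl a)).1
      | cast b => simpa using hcross a b
    rintro (u | u) (w | w) hadj'
    · simp at hadj'
    · exact key u w
    · exact (key w u).symm
    · simp at hadj'

theorem nm_le_of_not_choosable {k N : ℕ} (hk : 0 < k)
    (h : ¬ Choosable (completeBipartiteGraph (Fin (k + 2)) (Fin N)) k) : nm (k + 2) ≤ N := by
  classical
  have hex : ∃ n, ¬ Choosable (completeBipartiteGraph (Fin (k + 2)) (Fin n)) k := ⟨N, h⟩
  refine (Nat.sInf_le ?_).trans (Nat.find_min' hex h)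
  have hspec := Nat.find_spec hex
  have hmin := fun n => Nat.find_min hex (m := n)
  generalize Nat.find hex = n at hspec hmin
  obtain _ | n := n
  · exact absurd (choosable_completeBipartiteGraph_zero _ hk) hspec
  have hup := (not_not.1 (hmin n n.lt_succ_self)).completeBipartiteGraph_succ
  change sInf _ = k + 1
  refine le_antisymm (Nat.sInf_le hup) (le_csInf ⟨_, hup⟩ fun j hj => ?_)
  by_contra! hlt
  exact hspec (Choosable.mono (by omega) hj)

/-- If every system of representatives of the sets `A i` contains a member of `𝓑`, the lists
`A i` and `𝓑` witness that the complete bipartite graph is not choosable. -/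
theorem not_choosable_of_forall_exists_subset {ι γ : Type*} [Fintype ι] [Encodable γ]
    {m k : ℕ} (hm : Fintype.card ι = m) (A : ι → Finset γ) (𝓑 : Finset (Finset γ))
    (hA : ∀ i, (A i).card = k) (hB : ∀ B ∈ 𝓑, B.card = k)
    (h : ∀ c : ι → γ, (∀ i, c i ∈ A i) → ∃ B ∈ 𝓑, ∀ x ∈ B, ∃ i, c i = x) :
    ¬ Choosable (completeBipartiteGraph (Fin m) (Fin 𝓑.card)) k := by
  intro hch
  let e : γ ↪ ℕ := ⟨Encodable.encode, Encodable.encode_injective⟩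
  let f : ι ≃ Fin m := Fintype.equivFinOfCardEq hm
  obtain ⟨c, hc, hadj⟩ := hch (Sum.elim (fun a => (A (f.symm a)).map e)
      (fun b => (𝓑.equivFin.symm b : Finset γ).map e)) (by
    rintro (a | b)
    · simp [hA]
    · simpa using hB _ (𝓑.equivFin.symm b).2)
  have hl : ∀ i, ∃ x ∈ A i, e x = c (Sum.inl (f i)) := fun i => by
    simpa using hc (Sum.inl (f i))
  choose d hd hde using hl
  obtain ⟨B, hBm, hBd⟩ := h d hd
  have hr : ∃ x ∈ B, e x = c (Sum.inr (𝓑.equivFin ⟨B, hBm⟩)) := by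
    simpa using hc (Sum.inr (𝓑.equivFin ⟨B, hBm⟩))
  obtain ⟨x, hx, hxe⟩ := hr
  obtain ⟨i, rfl⟩ := hBd x hx
  exact hadj (Sum.inl (f i)) (Sum.inr (𝓑.equivFin ⟨B, hBm⟩)) (by simp)
    ((hde i).symm.trans hxe)

/-- Words over `Fin (r + 2)` in which both letters `0` and `1` occur. -/
def hittingWords (r : ℕ) : Finset (Fin (r + 2) → Fin (r + 2)) :=
  {g | (∃ i, g i = 0) ∧ ∃ i, g i = 1}

/-- Indices `(i, g)` for the sets `twoPointSet`: the word `g` vanishes at `i` and `i + 1`. -/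
def twoPointIndices (r : ℕ) : Finset (Fin (r + 2) × (Fin (r + 2) → Fin (r + 2))) :=
  {p | p.2 p.1 = 0 ∧ p.2 (p.1 + 1) = 0}

/-- The graph of a word. -/
def wordGraph {r : ℕ} (g : Fin (r + 2) → Fin (r + 2)) : Finset (Fin (r + 2) × Fin (r + 2)) :=
  univ.image fun i => (i, g i)

/-- The graph of a word off `i` and `i + 1`, together with `(i, 0)` and `(i, 1)`. -/
def twoPointSet {r : ℕ} (p : Fin (r + 2) × (Fin (r + 2) → Fin (r + 2))) :
    Finset (Fin (r + 2) × Fin (r + 2)) :=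
  insert (p.1, 0) (insert (p.1, 1) (({p.1, p.1 + 1}ᶜ : Finset _).image fun i => (i, p.2 i)))

theorem card_hittingWords_add (r : ℕ) :
    (hittingWords r).card + 2 * (r + 1) ^ (r + 2) = (r + 2) ^ (r + 2) + r ^ (r + 2) := by
  classical
  let P (s : Finset (Fin (r + 2))) : Finset (Fin (r + 2) → Fin (r + 2)) :=
    Fintype.piFinset fun _ => sᶜ
  have hP : ∀ s, (P s).card = (r + 2 - s.card) ^ (r + 2) := fun s => by
    simp [P, Finset.card_compl]
  have h1 : hittingWords r = (P {0} ∪ P {1})ᶜ := by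
    ext g; simp [hittingWords, P]
  have h2 : P {0} ∩ P {1} = P {0, 1} := by
    ext g; simp [P, forall_and]
  have h3 := Finset.card_union_add_card_inter (P {0}) (P {1})
  have h4 := Finset.card_compl_add_card (P {0} ∪ P {1})
  rw [← h1] at h4
  rw [h2, hP, hP, hP] at h3
  simp at h3 h4
  omega

theorem card_twoPointIndices (r : ℕ) :
    (twoPointIndices r).card = (r + 2) * (r + 2) ^ r := by
  classical
  have h : twoPointIndices r = (univ.sigma (fun i : Fin (r + 2) =>
      Fintype.piFinset fun l : Fin (r + 2) =>
        if l ∈ ({i, i + 1} : Finset (Fin (r + 2))) then {(0 : Fin (r + 2))} else univ)).map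
      (Equiv.sigmaEquivProd _ _).toEmbedding := by
    ext ⟨i, g⟩
    simp only [twoPointIndices, mem_filter, mem_univ, true_and, mem_map_equiv, mem_sigma,
      Fintype.mem_piFinset, Equiv.sigmaEquivProd_symm_apply]
    constructor
    · rintro ⟨h0, h1⟩ l
      split_ifs with hl
      · simp only [mem_insert, mem_singleton] at hl
        rcases hl with rfl | rfl <;> simp [*]
      · simp
    · intro h
      exact ⟨by simpa using h i, by simpa using h (i + 1)⟩
  rw [h, card_map, card_sigma]
  have : ∀ i : Fin (r + 2), (Fintype.piFinset fun l : Fin (r + 2) =>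
      if l ∈ ({i, i + 1} : Finset (Fin (r + 2))) then {(0 : Fin (r + 2))} else univ).card
      = (r + 2) ^ r := by
    intro i
    rw [Fintype.card_piFinset]
    have hc : ({i, i + 1}ᶜ : Finset (Fin (r + 2))).card = r := by
      rw [card_compl, card_pair (by simp)]; simp
    calc _ = ∏ l : Fin (r + 2), if l ∈ ({i, i + 1}ᶜ : Finset (Fin (r + 2))) then r + 2 else 1 := by
          refine prod_congr rfl fun l _ => ?_
          by_cases hl : l ∈ ({i, i + 1} : Finset (Fin (r + 2)))
          · rw [if_pos hl, if_neg (by simpa only [mem_compl, not_not] using hl)]; simp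
          · rw [if_neg hl, if_pos (mem_compl.2 hl)]; simp
      _ = _ := by rw [prod_ite_mem, univ_inter, prod_const, hc]
  rw [sum_congr rfl fun i _ => this i]
  simp

theorem card_wordGraph {r : ℕ} (g : Fin (r + 2) → Fin (r + 2)) :
    (wordGraph g).card = r + 2 := by
  rw [wordGraph, card_image_of_injective _ fun a b h => (Prod.ext_iff.1 h).1]
  simp

theorem card_twoPointSet {r : ℕ} (p : Fin (r + 2) × (Fin (r + 2) → Fin (r + 2))) :
    (twoPointSet p).card = r + 2 := by
  rw [twoPointSet, card_insert_of_notMem, card_insert_of_notMem,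
    card_image_of_injective _ fun a b h => (Prod.ext_iff.1 h).1, card_compl, card_pair (by simp)]
  · simp
  · simp
  · simp

/-- The lists on the smaller part: the rows and two columns of the square grid. -/
def gridLists (r : ℕ) : Fin (r + 2) ⊕ Bool → Finset (Fin (r + 2) × Fin (r + 2)) :=
  Sum.elim (fun i => {i} ×ˢ univ) (fun b => univ ×ˢ {if b then 1 else 0})

theorem exists_subset_of_mem_gridLists {r : ℕ} (c : Fin (r + 2) ⊕ Bool → Fin (r + 2) × Fin (r + 2))
    (hc : ∀ i, c i ∈ gridLists r i) :
    ∃ B ∈ (hittingWords r).image wordGraph ∪ (twoPointIndices r).image twoPointSet,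
      ∀ x ∈ B, ∃ i, c i = x := by
  have hrow : ∀ i, c (Sum.inl i) = (i, (c (Sum.inl i)).2) := fun i => by
    have := hc (Sum.inl i)
    simp only [gridLists, Sum.elim_inl, mem_product, mem_singleton] at this
    exact Prod.ext this.1 rfl
  have h0 : c (Sum.inr false) = ((c (Sum.inr false)).1, 0) := by
    have := hc (Sum.inr false)
    simp only [gridLists, Sum.elim_inr, mem_product, mem_singleton] at this
    exact Prod.ext rfl this.2
  have h1 : c (Sum.inr true) = ((c (Sum.inr true)).1, 1) := by
    have := hc (Sum.inr true)
    simp only [gridLists, Sum.elim_inr, mem_product, mem_singleton] at this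
    exact Prod.ext rfl this.2
  generalize (c (Sum.inr false)).1 = a at h0
  generalize (c (Sum.inr true)).1 = b at h1
  generalize hg : (fun i => (c (Sum.inl i)).2) = g
  replace hrow : ∀ i, c (Sum.inl i) = (i, g i) := fun i => by rw [hrow, ← hg]
  by_cases hab : a = b
  · subst hab
    let w := Function.update (Function.update g a 0) (a + 1) 0
    refine ⟨twoPointSet (a, w), mem_union_right _ (mem_image_of_mem _ ?_), ?_⟩
    · simp [twoPointIndices, w]
    · intro x hx
      simp only [twoPointSet, mem_insert, mem_image, mem_compl, mem_singleton, not_or] at hx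
      rcases hx with rfl | rfl | ⟨l, ⟨hl, hl'⟩, rfl⟩
      · exact ⟨_, h0⟩
      · exact ⟨_, h1⟩
      · exact ⟨Sum.inl l, by simp [hrow, w, hl, hl']⟩
  · let w := Function.update (Function.update g a 0) b 1
    refine ⟨wordGraph w, mem_union_left _ (mem_image_of_mem _ ?_), ?_⟩
    · simp only [hittingWords, mem_filter, mem_univ, true_and]
      exact ⟨⟨a, by simp [w, hab]⟩, ⟨b, by simp [w]⟩⟩
    · intro x hx
      simp only [wordGraph, mem_image, mem_univ, true_and] at hx
      obtain ⟨l, rfl⟩ := hx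
      by_cases hlb : l = b
      · exact ⟨Sum.inr true, by simp [h1, hlb, w]⟩
      · by_cases hla : l = a
        · exact ⟨Sum.inr false, by simp [h0, hla, w, hab]⟩
        · exact ⟨Sum.inl l, by simp [hrow, w, hla, hlb]⟩

theorem nm_add_le (r : ℕ) :
    nm (r + 4) + 2 * (r + 1) ^ (r + 2) ≤
      (r + 2) ^ (r + 2) + r ^ (r + 2) + (r + 2) * (r + 2) ^ r := by
  have h := nm_le_of_not_choosable (k := r + 2) (by omega)
    (not_choosable_of_forall_exists_subset (m := r + 2 + 2) (by simp) (gridLists r)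
      ((hittingWords r).image wordGraph ∪ (twoPointIndices r).image twoPointSet)
      (by rintro (i | b) <;> simp [gridLists])
      (by
        intro B hB
        simp only [mem_union, mem_image] at hB
        rcases hB with ⟨g, -, rfl⟩ | ⟨p, -, rfl⟩
        · exact card_wordGraph g
        · exact card_twoPointSet p)
      exists_subset_of_mem_gridLists)
  have h2 := (card_union_le ((hittingWords r).image wordGraph)
    ((twoPointIndices r).image twoPointSet)).trans
    (add_le_add card_image_le card_image_le)
  rw [card_twoPointIndices] at h2
  have h3 := card_hittingWords_add r
  change nm (r + 4) ≤ _ at h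
  omega

theorem eventually_ratio_lt :
    ∀ᶠ k : ℕ in atTop, 1 - 2 * (1 + (-1 : ℝ) / k) ^ k + (1 + (-2 : ℝ) / k) ^ k + 1 / (k : ℝ)
      < 0.4643 := by
  have h := (((Real.tendsto_one_add_div_pow_exp (-1)).const_mul 2).const_sub 1).add
    (Real.tendsto_one_add_div_pow_exp (-2)) |>.add tendsto_one_div_atTop_nhds_zero_nat
  refine h.eventually_lt_const ?_
  have he : Real.exp (-2) = Real.exp (-1) ^ 2 := by
    rw [← Real.exp_nat_mul]; norm_num
  have hlo := Real.exp_neg_one_gt_d9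
  have hhi := Real.exp_neg_one_lt_d9
  rw [he]
  nlinarith

theorem eventually_nm_le :
    ∀ᶠ k : ℕ in atTop, (nm (k + 2) : ℝ) ≤ 0.4643 * (k : ℝ) ^ k := by
  filter_upwards [eventually_ratio_lt, eventually_ge_atTop 2] with k hk hk2
  obtain ⟨r, rfl⟩ := Nat.exists_eq_add_of_le' hk2
  have h : (nm (r + 4) : ℝ) + 2 * (r + 1) ^ (r + 2) ≤
      (r + 2) ^ (r + 2) + r ^ (r + 2) + (r + 2) * (r + 2) ^ r := by
    exact_mod_cast nm_add_le r
  push_cast at hk ⊢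
  have hpos : (0 : ℝ) < r + 2 := by positivity
  have e1 : (1 + (-1 : ℝ) / (r + 2)) = (r + 1) / (r + 2) := by field_simp; ring
  have e2 : (1 + (-2 : ℝ) / (r + 2)) = r / (r + 2) := by field_simp; ring
  rw [e1, e2, div_pow, div_pow] at hk
  have hm := mul_le_mul_of_nonneg_right hk.le (pow_pos hpos (r + 2)).le
  have e3 : (1 - 2 * (((r : ℝ) + 1) ^ (r + 2) / (r + 2) ^ (r + 2)) +
      (r : ℝ) ^ (r + 2) / (r + 2) ^ (r + 2) + 1 / (r + 2)) * (r + 2) ^ (r + 2) =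
      (r + 2) ^ (r + 2) - 2 * (r + 1) ^ (r + 2) + r ^ (r + 2) + (r + 2) * (r + 2) ^ r := by
    have : ((r : ℝ) + 2) ^ (r + 2) ≠ 0 := (pow_pos hpos _).ne'
    have e4 : 1 / ((r : ℝ) + 2) * (r + 2) ^ (r + 2) = (r + 2) * (r + 2) ^ r := by
      rw [pow_succ]; field_simp; ring
    rw [add_mul, e4]
    field_simp
  rw [e3] at hm
  change (nm (r + 4) : ℝ) ≤ _
  linarith

/-- There is an infinite set `S` of positive integers such that for every `m ∈ S`,
`n_m ≤ 0.4643 (m-2)^(m-2)`. -/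
theorem nm_infinite_bound :
    ∃ S : Set ℕ, S.Infinite ∧ (∀ m ∈ S, 0 < m) ∧
      ∀ m ∈ S, (nm m : ℝ) ≤ 0.4643 * ((m : ℝ) - 2) ^ (m - 2) := by
  obtain ⟨K, hK⟩ := eventually_atTop.1 eventually_nm_le
  refine ⟨Set.Ici (K + 2), Set.Ici_infinite _, fun m hm => ?_, fun m hm => ?_⟩
  · simp only [Set.mem_Ici] at hm; omega
  · simp only [Set.mem_Ici] at hm
    obtain ⟨k, rfl⟩ := Nat.exists_eq_add_of_le' (show 2 ≤ m by omega)
    simpa using hK k (by omega)
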